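/- Let S and M be finite-dimensional Hilbert spaces, ρ_S a density matrix on S, {|X_x⟩}_{x∈X} and {|Z_z⟩}_{z∈Z} orthonormal bases of S, {|m⟩}_{m∈M} an orthonormal basis of M, and ℰ a completely positive trace-preserving map from operators on S to operators on S⊗M. Define the probability distributions P_Z(z) = ⟨Z_z|ρ_S|Z_z⟩, P^ℰ_Z(z) = tr[(|Z_z⟩⟨Z_z|⊗1_M) ℰ(ρ_S)], and Q^ℰ(m,x) = tr[(|X_x⟩⟨X_x|⊗|m⟩⟨m|) ℰ(ρ_S)]. Then for every α ∈ [1/2, ∞], D_α(P_Z ∥ P^ℰ_Z) + H_max(X|M)_{Q^ℰ} + H_α(P_Z) ≥ log₂(1/c), where c = max_{x,z} |⟨X_x|Z_z⟩|². -/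

import Mathlib

open scoped ENNReal
open scoped Classical

noncomputable section

/-- The classical Rényi relative entropy `D_α(P‖R)` (in bits) of nonnegative functions on a
finite set, for `α ∈ [1/2,∞]` (parametrized by `ℝ≥0∞`), with the limiting definitions at
`α = 1` (Kullback–Leibler divergence) and `α = ∞` (max-divergence); terms with `P z = 0`
contribute `0`, and the value is `+∞` if `α > 1` and some `P z > 0 = R z`. -/
def renyiDiv {Z : Type*} [Fintype Z] (α : ℝ≥0∞) (P R : Z → ℝ) : EReal :=
  if α = ⊤ then
    if ∀ z, P z ≠ 0 → R z ≠ 0 then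
      ((Real.logb 2 (⨆ z, if P z = 0 then 0 else P z / R z) : ℝ) : EReal)
    else ⊤
  else if α = 1 then
    if ∀ z, P z ≠ 0 → R z ≠ 0 then
      (((∑ z, if P z = 0 then 0 else P z * Real.logb 2 (P z / R z)) : ℝ) : EReal)
    else ⊤
  else
    if 1 < α.toReal ∧ ¬ (∀ z, P z ≠ 0 → R z ≠ 0) then ⊤
    else
      if 0 < (∑ z, if P z = 0 then 0 else (P z) ^ α.toReal * (R z) ^ (1 - α.toReal)) then
        (((α.toReal - 1)⁻¹ * Real.logb 2
          (∑ z, if P z = 0 then 0 else (P z) ^ α.toReal * (R z) ^ (1 - α.toReal)) : ℝ) : EReal)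
      else ⊤

/-- `P` is a probability distribution on a finite set. -/
def IsProbDist {Z : Type*} [Fintype Z] (P : Z → ℝ) : Prop :=
  (∀ z, 0 ≤ P z) ∧ ∑ z, P z = 1

/-- The classical conditional Rényi entropy
`H_α(A|B)_P = sup_η [ - D_α(P ‖ 1_A ⊗ η) ]`, the supremum running over probability
distributions `η` on `B`; `H_min = H_∞` and `H_max = H_{1/2}`. -/
def condRenyiC {A B : Type*} [Fintype A] [Fintype B] (α : ℝ≥0∞) (P : A × B → ℝ) : EReal :=
  sSup {x : EReal | ∃ η : B → ℝ, IsProbDist η ∧ x = - renyiDiv α P (fun z => η z.2)}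

end

noncomputable section

/-- The classical Rényi entropy `H_α(P)` (in bits) for `α ∈ [1/2,∞]`, with the Shannon
entropy at `α = 1` and the min-entropy `-log₂ max_z P(z)` at `α = ∞`. -/
def renyiEnt {Z : Type*} [Fintype Z] (α : ℝ≥0∞) (P : Z → ℝ) : ℝ :=
  if α = ⊤ then - Real.logb 2 (⨆ z, P z)
  else if α = 1 then - ∑ z, if P z = 0 then 0 else P z * Real.logb 2 (P z)
  else (1 - α.toReal)⁻¹ * Real.logb 2 (∑ z, if P z = 0 then 0 else (P z) ^ α.toReal)

/-- The classical conditional max-entropy `H_max(X|M)_Q = log₂ Σ_m (Σ_x √Q(m,x))²`. -/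
def condMaxEntC {M X : Type*} [Fintype M] [Fintype X] (Q : M × X → ℝ) : ℝ :=
  Real.logb 2 (∑ m, (∑ x, Real.sqrt (Q (m, x))) ^ 2)

/-- An orthonormal basis of `ℂ^n`, presented as a family of vectors that is both
orthonormal and complete. -/
def IsONB {I n : Type*} [Fintype I] [Fintype n] (V : I → n → ℂ) : Prop :=
  (∀ i j, ∑ s, starRingEnd ℂ (V i s) * V j s = if i = j then 1 else 0) ∧
  (∀ s s', ∑ i, V i s * starRingEnd ℂ (V i s') = if s = s' then 1 else 0)

/-- The extension `Φ ⊗ id_R` of a linear map on matrices to a bipartite system,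
acting blockwise. -/
def extendRight {S T R : Type*} [Fintype S] [Fintype T] [Fintype R]
    (Φ : Matrix S S ℂ →ₗ[ℂ] Matrix T T ℂ)
    (M : Matrix (S × R) (S × R) ℂ) : Matrix (T × R) (T × R) ℂ :=
  fun p q => Φ (fun s s' => M (s, p.2) (s', q.2)) p.1 q.1

open scoped ComplexOrder in
/-- Complete positivity: every matrix extension `Φ ⊗ id_k` maps positive
semidefinite matrices to positive semidefinite matrices. -/
def IsCompletelyPositive {S T : Type*} [Fintype S] [Fintype T]
    (Φ : Matrix S S ℂ →ₗ[ℂ] Matrix T T ℂ) : Prop :=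
  ∀ (k : ℕ) (M : Matrix (S × Fin k) (S × Fin k) ℂ),
    M.PosSemidef → (extendRight Φ M).PosSemidef

/-- Trace preservation. -/
def IsTracePreserving {S T : Type*} [Fintype S] [Fintype T]
    (Φ : Matrix S S ℂ →ₗ[ℂ] Matrix T T ℂ) : Prop :=
  ∀ M : Matrix S S ℂ, (Φ M).trace = M.trace

open scoped ComplexOrder in
/-- `ρ` is a density matrix. -/
def IsDensityMatrix {n : Type*} [Fintype n] (ρ : Matrix n n ℂ) : Prop :=
  ρ.PosSemidef ∧ ρ.trace = 1

end

theorem renyiDiv_eq_top_of_right_eq_zero {Z : Type*} [Fintype Z] (α : ℝ≥0∞) {P R : Z → ℝ}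
    (hP : ∃ z, P z ≠ 0) (hR : ∀ z, R z = 0) : renyiDiv α P R = ⊤ := by
  have hsupp : ¬ ∀ z, P z ≠ 0 → R z ≠ 0 := fun h => by
    obtain ⟨z, hz⟩ := hP
    exact h z hz (hR z)
  unfold renyiDiv
  split_ifs with h1 h2 h3 h4 <;> try rfl
  have hle : α.toReal ≤ 1 := not_lt.mp fun h => h3 ⟨h, hsupp⟩
  have hne : α.toReal ≠ 1 := fun h => h2 <| by
    rw [← ENNReal.ofReal_toReal h1, h, ENNReal.ofReal_one]
  have h0 : (1 - α.toReal) ≠ 0 := fun h => hne (by linarith)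
  simp [hR, Real.zero_rpow h0] at h4

theorem neg_logb_le_renyiDiv_add_renyiEnt {Z : Type*} [Fintype Z] (α : ℝ≥0∞) {P R : Z → ℝ}
    (hP : IsProbDist P) (hR : ∀ z, 0 ≤ R z) {B : ℝ} (hB : 0 < B) (hRB : ∀ z, R z ≤ B) :
    ((-Real.logb 2 B : ℝ) : EReal) ≤ renyiDiv α P R + (renyiEnt α P : ℝ) := by
  obtain ⟨hP0, hP1⟩ := hP
  obtain ⟨z₀, hz₀⟩ : ∃ z, P z ≠ 0 := by
    by_contra! h
    simp [h] at hP1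
  have : Nonempty Z := ⟨z₀⟩
  unfold renyiDiv renyiEnt
  have hpos : ∀ {z}, P z ≠ 0 → 0 < P z := fun {z} h => (hP0 z).lt_of_ne' h
  split_ifs with h1 h2 h3 h4 h5 h6
  · obtain ⟨y, hy⟩ := exists_eq_ciSup_of_finite (f := P)
    have hPy : 0 < P y := (hpos hz₀).trans_le (hy ▸ le_ciSup (Set.finite_range P).bddAbove z₀)
    have hRy : 0 < R y := (hR y).lt_of_ne' (h2 y hPy.ne')
    have hle := le_ciSup (f := fun z => if P z = 0 then 0 else P z / R z)
      (Set.finite_range _).bddAbove y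
    simp only [hPy.ne', if_false] at hle
    rw [← EReal.coe_add, EReal.coe_le_coe_iff, ← hy]
    have hlog := Real.logb_le_logb_of_le one_lt_two (div_pos hPy hRy) hle
    have hlogR := Real.logb_le_logb_of_le one_lt_two hRy (hRB y)
    rw [Real.logb_div hPy.ne' hRy.ne'] at hlog
    linarith
  · rw [EReal.top_add_coe]
    exact le_top
  · rw [← EReal.coe_add, EReal.coe_le_coe_iff, ← sub_eq_add_neg, ← Finset.sum_sub_distrib]
    have : -Real.logb 2 B = ∑ z, P z * -Real.logb 2 B := by rw [← Finset.sum_mul, hP1, one_mul]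
    rw [this]
    refine Finset.sum_le_sum fun z _ => ?_
    by_cases hz : P z = 0
    · simp [hz]
    have hRz : 0 < R z := (hR z).lt_of_ne' (h4 z hz)
    simp only [hz, if_false]
    rw [Real.logb_div hz hRz.ne', ← mul_sub]
    have hlogR := Real.logb_le_logb_of_le one_lt_two hRz (hRB z)
    exact mul_le_mul_of_nonneg_left (by linarith) (hP0 z)
  · rw [EReal.top_add_coe]
    exact le_top
  · rw [EReal.top_add_coe]
    exact le_top
  · rw [← EReal.coe_add, EReal.coe_le_coe_iff]
    set a := α.toReal
    have ha1 : a ≠ 1 := fun h => h3 <| by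
      rw [← ENNReal.ofReal_toReal h1, ← ENNReal.ofReal_one]
      exact congrArg _ h
    set T := ∑ z, if P z = 0 then 0 else P z ^ a * R z ^ (1 - a) with hT
    set E := ∑ z, if P z = 0 then 0 else P z ^ a with hE
    have hE0 : 0 < E := by
      refine Finset.sum_pos' (fun z _ => ?_) ⟨z₀, Finset.mem_univ _, ?_⟩
      · split_ifs
        · rfl
        · exact Real.rpow_nonneg (hP0 z) _
      · simpa only [hz₀, if_false] using Real.rpow_pos_of_pos (hpos hz₀) a
    have hlogEB : Real.logb 2 (E * B ^ (1 - a)) =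
        Real.logb 2 E + (1 - a) * Real.logb 2 B := by
      rw [Real.logb_mul hE0.ne' (Real.rpow_pos_of_pos hB _).ne',
        Real.logb_rpow_eq_mul_logb_of_pos hB]
    have hinv : (1 - a)⁻¹ = -(a - 1)⁻¹ := by rw [← inv_neg, neg_sub]
    have hcancel : (a - 1)⁻¹ * (a - 1) = 1 := inv_mul_cancel₀ (sub_ne_zero.mpr ha1)
    have key : (a - 1)⁻¹ * Real.logb 2 (E * B ^ (1 - a)) ≤ (a - 1)⁻¹ * Real.logb 2 T := by
      rcases lt_or_gt_of_ne ha1 with ha | ha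
      · refine mul_le_mul_of_nonpos_left (Real.logb_le_logb_of_le one_lt_two h6 ?_)
          (inv_nonpos.mpr (by linarith))
        rw [hT, hE, Finset.sum_mul]
        refine Finset.sum_le_sum fun z _ => ?_
        split_ifs
        · simp
        · exact mul_le_mul_of_nonneg_left
            (Real.rpow_le_rpow (hR z) (hRB z) (by linarith)) (Real.rpow_nonneg (hP0 z) _)
      · refine mul_le_mul_of_nonneg_left (Real.logb_le_logb_of_le one_lt_two (by positivity) ?_)
          (inv_nonneg.mpr (by linarith))
        have hs : ∀ z, P z ≠ 0 → R z ≠ 0 := by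
          by_contra hs
          exact h5 ⟨ha, hs⟩
        rw [hT, hE, Finset.sum_mul]
        refine Finset.sum_le_sum fun z _ => ?_
        split_ifs with hz
        · simp
        · exact mul_le_mul_of_nonneg_left
            (Real.rpow_le_rpow_of_nonpos ((hR z).lt_of_ne' (hs z hz)) (hRB z) (by linarith))
            (Real.rpow_nonneg (hP0 z) _)
    rw [hlogEB] at key
    rw [hinv]
    linear_combination key + Real.logb 2 B * hcancel
  · rw [EReal.top_add_coe]
    exact le_top

section Quantum

open Matrix
open scoped ComplexOrder MatrixOrder Matrix.Norms.L2Operator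

theorem Matrix.PosSemidef.exists_linearMap_norm_sq {n : Type*} [Fintype n] {A : Matrix n n ℂ}
    (hA : A.PosSemidef) : ∃ L : (n → ℂ) →ₗ[ℂ] EuclideanSpace ℂ n,
      ∀ v, (star v ⬝ᵥ A *ᵥ v).re = ‖L v‖ ^ 2 := by
  obtain ⟨B, rfl⟩ := CStarAlgebra.nonneg_iff_eq_star_mul_self.mp hA.nonneg
  refine ⟨(WithLp.linearEquiv 2 ℂ (n → ℂ)).symm.toLinearMap ∘ₗ B.mulVecLin, fun v => ?_⟩
  rw [star_eq_conjTranspose, ← mulVec_mulVec, dotProduct_mulVec, ← star_mulVec,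
    EuclideanSpace.norm_sq_eq, dotProduct, Complex.re_sum]
  refine Finset.sum_congr rfl fun i _ => ?_
  simp [← Complex.normSq_eq_norm_sq, Complex.normSq_apply]

theorem IsCompletelyPositive.posSemidef_apply {S T : Type*} [Fintype S] [Fintype T]
    {Φ : Matrix S S ℂ →ₗ[ℂ] Matrix T T ℂ} (hΦ : IsCompletelyPositive Φ)
    {ρ : Matrix S S ℂ} (hρ : ρ.PosSemidef) : (Φ ρ).PosSemidef :=
  (hΦ 1 _ (hρ.submatrix Prod.fst)).submatrix fun p => (p, 0)

theorem IsONB.sum_inner_smul {I n : Type*} [Fintype I] [Fintype n] {V : I → n → ℂ}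
    (hV : IsONB V) (v : n → ℂ) :
    ∑ i, (∑ s, starRingEnd ℂ (V i s) * v s) • V i = v := by
  ext s
  simp only [Finset.sum_apply, Pi.smul_apply, smul_eq_mul, Finset.sum_mul]
  rw [Finset.sum_comm]
  have h (t : n) : ∑ i, starRingEnd ℂ (V i t) * v t * V i s = if s = t then v t else 0 := by
    calc _ = (∑ i, V i s * starRingEnd ℂ (V i t)) * v t := by
          rw [Finset.sum_mul]
          exact Finset.sum_congr rfl fun i _ => by ring
      _ = _ := by rw [hV.2]; split_ifs <;> simp
  simp [h]

theorem IsONB.sum_quadraticForm_eq_trace {I n : Type*} [Fintype I] [Fintype n] {V : I → n → ℂ}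
    (hV : IsONB V) (A : Matrix n n ℂ) :
    ∑ i, star (V i) ⬝ᵥ A *ᵥ V i = A.trace := by
  calc _ = ∑ s, ∑ t, A s t * ∑ i, V i t * starRingEnd ℂ (V i s) := by
        simp only [dotProduct, mulVec, Finset.mul_sum]
        rw [Finset.sum_comm]
        refine Finset.sum_congr rfl fun s _ => ?_
        rw [Finset.sum_comm]
        refine Finset.sum_congr rfl fun t _ => Finset.sum_congr rfl fun i _ => ?_
        simp only [Pi.star_apply, RCLike.star_def]
        ring
    _ = A.trace := by simp [hV.2, Matrix.trace]

/-- If every `⟨Vᵢ|v⟩` has squared modulus at most `c`, then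
`⟨v ⊗ w|A|v ⊗ w⟩ ≤ c (∑ᵢ √⟨Vᵢ ⊗ w|A|Vᵢ ⊗ w⟩)²` for positive semidefinite `A`. -/
theorem IsONB.quadraticForm_tensor_le {I S M : Type*} [Fintype I] [Fintype S] [Fintype M]
    {V : I → S → ℂ} (hV : IsONB V) {A : Matrix (S × M) (S × M) ℂ} (hA : A.PosSemidef)
    (v : S → ℂ) (w : M → ℂ) {c : ℝ} (hc : 0 ≤ c)
    (hle : ∀ i, ‖∑ s, starRingEnd ℂ (V i s) * v s‖ ^ 2 ≤ c) :
    (star (fun p : S × M => v p.1 * w p.2) ⬝ᵥ A *ᵥ fun p => v p.1 * w p.2).re ≤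
      c * (∑ i, √(star (fun p : S × M => V i p.1 * w p.2) ⬝ᵥ
        A *ᵥ fun p => V i p.1 * w p.2).re) ^ 2 := by
  obtain ⟨L, hL⟩ := hA.exists_linearMap_norm_sq
  simp only [hL, Real.sqrt_sq (norm_nonneg _)]
  have hexp : (fun p : S × M => v p.1 * w p.2) =
      ∑ i, (∑ s, starRingEnd ℂ (V i s) * v s) • fun p : S × M => V i p.1 * w p.2 := by
    ext p
    conv_lhs => rw [← hV.sum_inner_smul v]
    simp only [Finset.sum_apply, Pi.smul_apply, smul_eq_mul,
      Finset.sum_mul (s := Finset.univ (α := I)), mul_assoc]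
  calc _ ≤ (√c * ∑ i, ‖L fun p => V i p.1 * w p.2‖) ^ 2 := by
        refine pow_le_pow_left₀ (norm_nonneg _) ?_ 2
        rw [hexp, map_sum, Finset.mul_sum]
        refine (norm_sum_le _ _).trans (Finset.sum_le_sum fun i _ => ?_)
        rw [map_smul, norm_smul]
        exact mul_le_mul_of_nonneg_right (Real.le_sqrt_of_sq_le (hle i)) (norm_nonneg _)
    _ = _ := by rw [mul_pow, Real.sq_sqrt hc]

theorem star_dotProduct_mulVec_tensor {S M : Type*} [Fintype S] [Fintype M]
    (A : Matrix (S × M) (S × M) ℂ) (v : S → ℂ) (w : M → ℂ) :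
    star (fun p : S × M => v p.1 * w p.2) ⬝ᵥ A *ᵥ (fun p => v p.1 * w p.2) =
      ∑ s, ∑ s', ∑ m₁, ∑ m₂, v s * starRingEnd ℂ (v s') *
        w m₁ * starRingEnd ℂ (w m₂) * A (s', m₂) (s, m₁) := by
  simp only [dotProduct, mulVec, Finset.mul_sum, Fintype.sum_prod_type]
  trans ∑ s', ∑ s, ∑ m₂, ∑ m₁, v s * starRingEnd ℂ (v s') *
        w m₁ * starRingEnd ℂ (w m₂) * A (s', m₂) (s, m₁)
  · refine Finset.sum_congr rfl fun s' _ => ?_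
    rw [Finset.sum_comm]
    refine Finset.sum_congr rfl fun s _ => Finset.sum_congr rfl fun m₂ _ =>
      Finset.sum_congr rfl fun m₁ _ => ?_
    simp only [Pi.star_apply, RCLike.star_def, map_mul]
    ring
  · rw [Finset.sum_comm]
    exact Finset.sum_congr rfl fun s _ => Finset.sum_congr rfl fun s' _ => Finset.sum_comm

theorem IsONB.sum_quadraticForm_tensor {I S M : Type*} [Fintype I] [Fintype S] [Fintype M]
    {W : I → M → ℂ} (hW : IsONB W) (A : Matrix (S × M) (S × M) ℂ) (v : S → ℂ) :
    ∑ i, star (fun p : S × M => v p.1 * W i p.2) ⬝ᵥ A *ᵥ (fun p => v p.1 * W i p.2) =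
      ∑ s, ∑ s', ∑ m, v s * starRingEnd ℂ (v s') * A (s', m) (s, m) := by
  simp only [star_dotProduct_mulVec_tensor]
  rw [Finset.sum_comm]
  refine Finset.sum_congr rfl fun s _ => ?_
  rw [Finset.sum_comm]
  refine Finset.sum_congr rfl fun s' _ => ?_
  rw [Finset.sum_comm]
  refine Finset.sum_congr rfl fun m₁ _ => ?_
  rw [Finset.sum_comm]
  calc _ = ∑ m₂, v s * starRingEnd ℂ (v s') * A (s', m₂) (s, m₁) *
        ∑ i, W i m₁ * starRingEnd ℂ (W i m₂) := by
        simp only [Finset.mul_sum]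
        exact Finset.sum_congr rfl fun m₂ _ => Finset.sum_congr rfl fun i _ => by ring
    _ = _ := by simp [hW.2]

end Quantum

/-- **Entropic measurement-disturbance relation, classical form**: for a state `ρ_S`,
orthonormal bases `X`, `Z` of `S`, and a CPTP map `ℰ : S → S ⊗ M`,
`D_α(P_Z ‖ P^ℰ_Z) + H_max(X|M)_{Q^ℰ} + H_α(P_Z) ≥ log₂(1/c)` for all `α ∈ [1/2,∞]`,
where `c = max_{x,z} |⟨X_x|Z_z⟩|²`. -/
theorem measurement_disturbance_relation_classical
    {S M XI ZI MI : Type*}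
    [Fintype S] [DecidableEq S] [Fintype M] [DecidableEq M]
    [Fintype XI] [Nonempty XI] [Fintype ZI] [Nonempty ZI] [Fintype MI]
    (ρS : Matrix S S ℂ) (hρ : IsDensityMatrix ρS)
    (Xv : XI → S → ℂ) (hX : IsONB Xv)
    (Zv : ZI → S → ℂ) (hZ : IsONB Zv)
    (Mv : MI → M → ℂ) (hM : IsONB Mv)
    (ℰ : Matrix S S ℂ →ₗ[ℂ] Matrix (S × M) (S × M) ℂ)
    (hCP : IsCompletelyPositive ℰ) (hTP : IsTracePreserving ℰ)
    -- P_Z(z) = ⟨Z_z|ρ_S|Z_z⟩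
    (PZ : ZI → ℝ)
    (hPZ : PZ = fun z => (∑ s, ∑ s', starRingEnd ℂ (Zv z s) * ρS s s' * Zv z s').re)
    -- P^ℰ_Z(z) = tr[(|Z_z⟩⟨Z_z| ⊗ 1_M) ℰ(ρ_S)]
    (PZE : ZI → ℝ)
    (hPZE : PZE = fun z =>
      (∑ s, ∑ s', ∑ m, Zv z s * starRingEnd ℂ (Zv z s') * ℰ ρS (s', m) (s, m)).re)
    -- Q^ℰ(m,x) = tr[(|X_x⟩⟨X_x| ⊗ |m⟩⟨m|) ℰ(ρ_S)]
    (Q : MI × XI → ℝ)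
    (hQ : Q = fun p =>
      (∑ s, ∑ s', ∑ m₁, ∑ m₂, Xv p.2 s * starRingEnd ℂ (Xv p.2 s') *
        Mv p.1 m₁ * starRingEnd ℂ (Mv p.1 m₂) * ℰ ρS (s', m₂) (s, m₁)).re)
    -- c = max_{x,z} |⟨X_x|Z_z⟩|²
    (c : ℝ) (hc : c = ⨆ x : XI, ⨆ z : ZI, ‖∑ s, starRingEnd ℂ (Xv x s) * Zv z s‖ ^ 2)
    (α : ℝ≥0∞) (hα : 1 / 2 ≤ α) :
    renyiDiv α PZ PZE + ((condMaxEntC Q : ℝ) : EReal) + ((renyiEnt α PZ : ℝ) : EReal)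
      ≥ ((Real.logb 2 (1 / c) : ℝ) : EReal) := by
  have hσ := hCP.posSemidef_apply hρ.1
  set σ := ℰ ρS
  have hPform : ∀ z, PZ z = (star (Zv z) ⬝ᵥ ρS.mulVec (Zv z)).re := fun z => by
    simp only [hPZ, dotProduct, Matrix.mulVec, Finset.mul_sum, ← mul_assoc]
    rfl
  have hEform : ∀ z, PZE z = ∑ m, (star (fun p : S × M => Zv z p.1 * Mv m p.2) ⬝ᵥ
      σ.mulVec fun p => Zv z p.1 * Mv m p.2).re := fun z => by
    rw [hPZE, ← Complex.re_sum, hM.sum_quadraticForm_tensor]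
  have hQform : ∀ m x, Q (m, x) = (star (fun p : S × M => Xv x p.1 * Mv m p.2) ⬝ᵥ
      σ.mulVec fun p => Xv x p.1 * Mv m p.2).re := fun m x => by
    rw [hQ, star_dotProduct_mulVec_tensor]
  have hP : IsProbDist PZ := by
    refine ⟨fun z => (hPform z).symm ▸ hρ.1.re_dotProduct_nonneg _, ?_⟩
    simp only [hPform]
    rw [← Complex.re_sum, hZ.sum_quadraticForm_eq_trace, hρ.2, Complex.one_re]
  have hE0 : ∀ z, 0 ≤ PZE z := fun z =>
    (hEform z).symm ▸ Finset.sum_nonneg fun m _ => hσ.re_dotProduct_nonneg _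
  have hcle : ∀ x z, ‖∑ s, starRingEnd ℂ (Xv x s) * Zv z s‖ ^ 2 ≤ c := fun x z => hc ▸
    (le_ciSup (f := fun z => ‖∑ s, starRingEnd ℂ (Xv x s) * Zv z s‖ ^ 2)
      (Set.finite_range _).bddAbove z).trans
    (le_ciSup (f := fun x => ⨆ z, ‖∑ s, starRingEnd ℂ (Xv x s) * Zv z s‖ ^ 2)
      (Set.finite_range _).bddAbove x)
  have hc0 : 0 ≤ c := hc ▸ Real.iSup_nonneg fun x => Real.iSup_nonneg fun z => by positivity
  set K := ∑ m, (∑ x, √(Q (m, x))) ^ 2 with hK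
  have hK0 : 0 ≤ K := Finset.sum_nonneg fun m _ => sq_nonneg _
  have hEB : ∀ z, PZE z ≤ c * K := fun z => by
    rw [hEform, hK, Finset.mul_sum]
    refine Finset.sum_le_sum fun m _ => ?_
    simp only [hQform]
    exact hX.quadraticForm_tensor_le hσ (Zv z) (Mv m) hc0 fun x => hcle x z
  rcases (mul_nonneg hc0 hK0).eq_or_lt with hB | hB
  · have hne : ∃ z, PZ z ≠ 0 := by
      by_contra! h
      simp [IsProbDist, h] at hP
    rw [renyiDiv_eq_top_of_right_eq_zero α hne fun z => le_antisymm (hB ▸ hEB z) (hE0 z)]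
    simp
  · have hcpos : c ≠ 0 := left_ne_zero_of_mul hB.ne'
    have hKpos : K ≠ 0 := right_ne_zero_of_mul hB.ne'
    have hlog : Real.logb 2 (1 / c) = -Real.logb 2 (c * K) + condMaxEntC Q := by
      rw [condMaxEntC, ← hK, Real.logb_mul hcpos hKpos, one_div, Real.logb_inv]
      ring
    rw [ge_iff_le, hlog, EReal.coe_add, add_right_comm]
    exact add_le_add_left (neg_logb_le_renyiDiv_add_renyiEnt α hP hE0 hB hEB) _
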